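/- For every α ∈ 2^ω, the set S_{β_α} satisfies condition (M). In particular, A^{S_{β_α}} is ≤ʳ_c-minimal among non-pot(Π⁰₁) Borel sets. -/

import Mathlib

open Set Topology

abbrev Cantor : Type := ℕ → Bool

/-- `A ⊆ X × Y` is potentially closed (`pot(Π⁰₁)`): there are finer Polish topologies on `X`
and `Y` making `A` closed in the product. -/
def PotClosed {X Y : Type} (tX : TopologicalSpace X) (tY : TopologicalSpace Y)
    (A : Set (X × Y)) : Prop :=
  ∃ (σ : TopologicalSpace X) (τ : TopologicalSpace Y),
    σ ≤ tX ∧ τ ≤ tY ∧ @PolishSpace X σ ∧ @PolishSpace Y τ ∧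
    @IsClosed (X × Y) (@instTopologicalSpaceProd X Y σ τ) A

/-- Membership in the class `D₂(Σ⁰₁)`: difference of two open sets. -/
def D2Sigma01 {Z : Type} (t : TopologicalSpace Z) (A : Set Z) : Prop :=
  ∃ U V : Set Z, @IsOpen Z t U ∧ @IsOpen Z t V ∧ A = U \ V

/-- The rectangular continuous reducibility `A ≤ʳ_c A'`. -/
def RedRC {X Y X' Y' : Type} (tX : TopologicalSpace X) (tY : TopologicalSpace Y)
    (tX' : TopologicalSpace X') (tY' : TopologicalSpace Y')
    (A : Set (X × Y)) (A' : Set (X' × Y')) : Prop :=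
  ∃ (u : X → X') (v : Y → Y'),
    @Continuous X X' tX tX' u ∧ @Continuous Y Y' tY tY' v ∧
    A = (fun p => (u p.1, v p.2)) ⁻¹' A'

/-- `≤ʳ_c` on subsets of `Cantor × Cantor` with the standard topology. -/
def RedC2 (A A' : Set (Cantor × Cantor)) : Prop :=
  RedRC inferInstance inferInstance inferInstance inferInstance A A'

/-- `A` is `≤ʳ_c`-minimal among non-potentially closed Borel sets. -/
def MinNonPotClosed {X Y : Type} (tX : TopologicalSpace X) (tY : TopologicalSpace Y)
    (A : Set (X × Y)) : Prop :=
  ¬ PotClosed tX tY A ∧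
  ∀ (X' Y' : Type) (tX' : TopologicalSpace X') (tY' : TopologicalSpace Y'),
    @PolishSpace X' tX' → @PolishSpace Y' tY' →
    ∀ A' : Set (X' × Y'),
      @MeasurableSet (X' × Y') (@borel (X' × Y') (@instTopologicalSpaceProd X' Y' tX' tY')) A' →
      ¬ PotClosed tX' tY' A' →
      RedRC tX' tY' tX tY A' A → RedRC tX tY tX' tY' A A'

/-- The Borel reducibility `A ≤_B A'` for square sets. -/
def RedB {Z Z' : Type} (tZ : TopologicalSpace Z) (tZ' : TopologicalSpace Z')
    (A : Set (Z × Z)) (A' : Set (Z' × Z'))  : Prop :=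
  ∃ u : Z → Z', @Measurable Z Z' (@borel Z tZ) (@borel Z' tZ') u ∧
    A = (fun p => (u p.1, u p.2)) ⁻¹' A'

/-- `A` is `≤_B`-minimal among non-potentially closed Borel (square) sets. -/
def MinBNonPotClosed {Z : Type} (tZ : TopologicalSpace Z) (A : Set (Z × Z)) : Prop :=
  ¬ PotClosed tZ tZ A ∧
  ∀ (Z' : Type) (tZ' : TopologicalSpace Z'), @PolishSpace Z' tZ' →
    ∀ A' : Set (Z' × Z'),
      @MeasurableSet (Z' × Z') (@borel (Z' × Z') (@instTopologicalSpaceProd Z' Z' tZ' tZ')) A' →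
      ¬ PotClosed tZ' tZ' A' →
      RedB tZ' tZ A' A → RedB tZ tZ' A A'

/-- The graph of the partial function `f` with domain `D`. -/
def graphRel {X : Type} (D : Set X) (f : X → X) : Set (X × X) :=
  {p | p.1 ∈ D ∧ p.2 = f p.1}

/-- `A^f := ⋃ₙ Graph(fₙ)`. -/
def unionGraphs {X : Type} (D : ℕ → Set X) (f : ℕ → X → X) : Set (X × X) :=
  ⋃ n, graphRel (D n) (f n)

/-- `f` restricted to `D` is a partial homeomorphism with clopen domain and clopen range. -/
def IsPartialHomeo {X : Type} (t : TopologicalSpace X) (D : Set X) (f : X → X) : Prop :=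
  @IsClopen X t D ∧ @IsClopen X t (f '' D) ∧ @ContinuousOn X X t t f D ∧
    ∃ g : X → X, @ContinuousOn X X t t g (f '' D) ∧ ∀ x ∈ D, g (f x) = x

/-- A converging situation: a nonempty zero-dimensional perfect Polish space together with
partial homeomorphisms with clopen domains and ranges such that
`Δ(X) = closure(A^f) \ A^f`. -/
def ConvSit (X : Type) (t : TopologicalSpace X) (D : ℕ → Set X) (f : ℕ → X → X) : Prop :=
  Nonempty X ∧ @PolishSpace X t ∧
  @TopologicalSpace.IsTopologicalBasis X t {s : Set X | @IsClopen X t s} ∧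
  @Perfect X t Set.univ ∧
  (∀ n, IsPartialHomeo t (D n) (f n)) ∧
  Set.diagonal X =
    @closure (X × X) (@instTopologicalSpaceProd X X t t) (unionGraphs D f) \ unionGraphs D f

/-- The domain of the restriction `f^B` of the partial map `(D, f)` to a subset `B`. -/
def subD {X : Type} (B : Set X) (D : Set X) (f : X → X) : Set ↥B :=
  {x | (x : X) ∈ D ∧ f (x : X) ∈ B}

/-- The restriction `f^B` of `f` to `B`, as a map of the subtype (junk value outside). -/
noncomputable def subF {X : Type} (B : Set X) (f : X → X) : ↥B → ↥B :=
  fun x =>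
    letI := Classical.dec (f (x : X) ∈ B)
    if h : f (x : X) ∈ B then ⟨f (x : X), h⟩ else x

/-- `A^f ∩ B²`, viewed on the subtype `B`: the union of the graphs of the `f^B_n`'s. -/
def restrGraphs {X : Type} (B : Set X) (D : ℕ → Set X) (f : ℕ → X → X) : Set (↥B × ↥B) :=
  unionGraphs (fun n => subD B (D n) (f n)) (fun n => subF B (f n))

/-- The subspace topology on `B` induced by a topology `t` on `X`. -/
def subTop {X : Type} (t : TopologicalSpace X) (B : Set X) : TopologicalSpace ↥B :=
  @TopologicalSpace.induced ↥B X Subtype.val t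

/-- The natural bijection `ψ : ω → 2^{<ω}` (enumeration by length, then lexicographically):
`ψ(n)` is the binary expansion of `n+1` with its leading one removed. -/
def psiSeq (n : ℕ) : List Bool := ((n + 1).bits.dropLast).reverse

/-- `s_n := ψ(n)0^{n-|ψ(n)|}`, a dense sequence with `|s_n| = n`. -/
def sSeq (n : ℕ) : List Bool := psiSeq n ++ List.replicate (n - (psiSeq n).length) false

/-- The concatenation `sγ` of a finite sequence `s` with `γ ∈ 2^ω`. -/
def catSeq (s : List Bool) (γ : Cantor) : Cantor :=
  fun i => if h : i < s.length then s.get ⟨i, h⟩ else γ (i - s.length)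

/-- `A₁ := {(s_n0γ, s_n1γ) : n ∈ ω, γ ∈ 2^ω}`. -/
def A1 : Set (Cantor × Cantor) :=
  {p | ∃ (n : ℕ) (γ : Cantor),
    p.1 = catSeq (sSeq n ++ [false]) γ ∧ p.2 = catSeq (sSeq n ++ [true]) γ}

/-- `Card(x↾n)`: the number of ones among the first `n` coordinates of `x`. -/
def cardOnes (x : Cantor) (n : ℕ) : ℕ := ∑ i ∈ Finset.range n, (if x i then 1 else 0)

/-- The domain of `f^S_n`: sequences vanishing at `n` whose first `n` coordinates contain a
number of ones belonging to `S`. -/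
def DSdom (S : Set ℕ) (n : ℕ) : Set Cantor := {x | x n = false ∧ cardOnes x n ∈ S}

/-- `f^S_n (s0γ) := s1γ`: flip the `n`-th coordinate to one. -/
def fSfun (n : ℕ) : Cantor → Cantor := fun x => Function.update x n true

/-- `A^S := {(s0γ, s1γ) : s ∈ 2^{<ω}, Card(s) ∈ S, γ ∈ 2^ω} = ⋃ₙ Graph(f^S_n)`. -/
def ASet (S : Set ℕ) : Set (Cantor × Cantor) := unionGraphs (DSdom S) fSfun

/-- Condition (M) on `S ⊆ ω`. -/
def CondM (S : Set ℕ) : Prop :=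
  ∀ p : ℕ, ∃ k : ℕ, ∀ q : ℕ, ∃ c : ℕ, q ≤ c ∧ c ≤ q + k ∧
    (fun m => c + m) '' (S ∩ Set.Iic p) = S ∩ Set.Icc c (c + p)

/-- Condition (H) on `S ⊆ ω`. -/
def CondH (S : Set ℕ) : Prop :=
  ∀ C : Set Cantor, @MeasurableSet Cantor (borel Cantor) C →
    ∀ σ : TopologicalSpace ↥C, σ ≤ subTop inferInstance C →
      ConvSit ↥C σ (fun n => subD C (DSdom S n) (fSfun n)) (fun n => subF C (fSfun n)) →
      ∀ l p : ℕ, ∃ n : ℕ, l ≤ n ∧ ∃ γ : ↥C, γ ∈ subD C (DSdom S n) (fSfun n) ∧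
        (fun m => cardOnes (γ : Cantor) n + m) '' (S ∩ Set.Iic p) =
          S ∩ Set.Icc (cardOnes (γ : Cantor) n) (cardOnes (γ : Cantor) n + p)

/-- Condition (⊥) on a pair `(S, S')`. -/
def CondPerp (S S' : Set ℕ) : Prop :=
  ∃ p : ℕ, ∀ c : ℕ, (fun m => c + m) '' (S ∩ Set.Iic p) ≠ S' ∩ Set.Icc c (c + p)

/-- Condition (⊥⁻¹) on a pair `(S, S')` (stated in `ℤ` to handle subtraction). -/
def CondPerpInv (S S' : Set ℕ) : Prop :=
  ∃ p : ℕ, ∀ c : ℕ,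
    (fun m : ℕ => (c : ℤ) - (m : ℤ)) '' (S ∩ Set.Iic p) ≠
      ((fun n : ℕ => (n : ℤ)) '' S') ∩ Set.Icc ((c : ℤ) - (p : ℤ)) (c : ℤ)

/-- `A⁻¹ := {(y,x) : (x,y) ∈ A}`. -/
def invRel {X : Type} (A : Set (X × X)) : Set (X × X) := {p | (p.2, p.1) ∈ A}

/-- `γ_α`: `γ_α(4n+2ε) = ε` and `γ_α(2n+1) = α(n)`. -/
def gammaSeq (α : Cantor) (k : ℕ) : Bool :=
  if k % 2 = 1 then α (k / 2) else decide (k % 4 = 2)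

/-- `β_α(i) := γ_α((i)₀)` where `(i)₀ = max {m : 2^m ∣ i+1}`, with values in `{0,1} ⊆ ω`. -/
def betaSeq (α : Cantor) (i : ℕ) : ℕ :=
  if gammaSeq α ((i + 1).factorization 2) then 1 else 0

/-- `S_β := {Σ_{i<l} (1 + β(i)) : l ∈ ω}`. -/
def Sbeta (β : ℕ → ℕ) : Set ℕ :=
  {m | ∃ l : ℕ, m = ∑ i ∈ Finset.range l, (1 + β i)}

/-- `s_n` as a function `ℕ → Bool` (with junk value `false` beyond `n`). -/
def sSeqFn (n : ℕ) (i : ℕ) : Bool := (sSeq n).getD i false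

/-- The domain of `f¹_n` (direction `d = true`) or of `(f¹_n)⁻¹` (direction `d = false`):
`x` extends `s_n` and `x(n) = !d`. -/
def step1Dom (n : ℕ) (d : Bool) : Set Cantor :=
  {x | (∀ i, i < n → x i = sSeqFn n i) ∧ x n = !d}

/-- `f¹_n` (if `d = true`) or its inverse (if `d = false`): set the `n`-th coordinate to `d`. -/
def step1Fun (n : ℕ) (d : Bool) : Cantor → Cantor := fun x => Function.update x n d

/-- Domain of `fₙ` (direction `d = true`) or of `fₙ⁻¹` (direction `d = false`). -/
def stepDom {X : Type} (D : ℕ → Set X) (f : ℕ → X → X) (n : ℕ) (d : Bool) : Set X :=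
  if d then D n else f n '' D n

/-- `fₙ` (direction `d = true`) or its inverse `gₙ` (direction `d = false`). -/
def stepFun {X : Type} (f g : ℕ → X → X) (n : ℕ) (d : Bool) : X → X :=
  if d then f n else g n

/-- An acyclic situation (Definition 26), with `g n` the inverse of `f n`. -/
def AcyclicSit (X : Type) (t : TopologicalSpace X) (D : ℕ → Set X) (f g : ℕ → X → X) : Prop :=
  Nonempty X ∧ @PolishSpace X t ∧
  @TopologicalSpace.IsTopologicalBasis X t {s : Set X | @IsClopen X t s} ∧
  @Perfect X t Set.univ ∧
  (∀ n, IsPartialHomeo t (D n) (f n)) ∧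
  (∀ n, ∀ x ∈ D n, g n (f n x) = x) ∧
  Set.diagonal X ⊆
    @closure (X × X) (@instTopologicalSpaceProd X X t t) (unionGraphs D f) \ unionGraphs D f ∧
  (∀ m : ℕ, 1 ≤ m → ∀ (v : ℕ → ℕ) (ε : ℕ → Bool),
    (∀ i, i + 1 < m → v i ≠ v (i + 1) ∨ ε i = ε (i + 1)) →
    ∀ U : Set X, @IsClopen X t U → U.Nonempty →
      ∃ V : Set X, @IsClopen X t V ∧ V.Nonempty ∧ V ⊆ U ∧
        ∀ x ∈ V, ∀ w : ℕ → X, w 0 = x →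
          (∀ i, i < m → w i ∈ stepDom D f (v i) (ε i) ∧
            w (i + 1) = stepFun f g (v i) (ε i) (w i)) →
          w m ∉ V)

/-- The relation `ℜ_Θ` on `2^{<ω}`: `e ℜ_Θ e'` iff `e = e'` or
`(e, e') = (θ_n0w, θ_n1w)` for some `n` and `w`. -/
def RTheta (θ : ℕ → List Bool) (e e' : List Bool) : Prop :=
  e = e' ∨ ∃ (n : ℕ) (w : List Bool), e = θ n ++ false :: w ∧ e' = θ n ++ true :: w

/-- The symmetrization `s(ℜ_Θ)`. -/
def sRTheta (θ : ℕ → List Bool) (e e' : List Bool) : Prop :=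
  RTheta θ e e' ∨ RTheta θ e' e

section CombinatoricsOfS

/-- The integers `c` at which `S` looks like `S ∩ [0, k]` on the window `[c, c + k]`. -/
def recurrencePts (S : Set ℕ) (k : ℕ) : Set ℕ := {c | ∀ m ≤ k, m ∈ S ↔ c + m ∈ S}

theorem recurrencePts_subset {S : Set ℕ} (h0 : 0 ∈ S) (k : ℕ) : recurrencePts S k ⊆ S :=
  fun c hc => by simpa using (hc 0 (Nat.zero_le k)).1 h0

theorem mem_recurrencePts_iff {S : Set ℕ} {c k : ℕ} :
    c ∈ recurrencePts S k ↔
      (fun m => c + m) '' (S ∩ Set.Iic k) = S ∩ Set.Icc c (c + k) := by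
  constructor
  · intro h
    ext x
    simp only [mem_image, mem_inter_iff, mem_Iic, mem_Icc]
    constructor
    · rintro ⟨m, ⟨hm, hk⟩, rfl⟩
      exact ⟨(h m hk).1 hm, by omega, by omega⟩
    · rintro ⟨hx, h1, h2⟩
      refine ⟨x - c, ⟨(h (x - c) (by omega)).2 ?_, by omega⟩, by omega⟩
      rwa [Nat.add_sub_cancel' h1]
  · intro h m hm
    have := Set.ext_iff.1 h (c + m)
    simp only [mem_image, mem_inter_iff, mem_Iic, mem_Icc] at this
    constructor
    · intro hS
      exact (this.1 ⟨m, ⟨hS, hm⟩, rfl⟩).1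
    · intro hS
      obtain ⟨m', ⟨h1, _⟩, h3⟩ := this.2 ⟨hS, by omega, by omega⟩
      rwa [Nat.add_left_cancel h3] at h1

theorem CondM.exists_recurrence {S : Set ℕ} (hM : CondM S) (k : ℕ) :
    ∃ K, ∀ q, ∃ c ∈ recurrencePts S k, q ≤ c ∧ c ≤ q + K := by
  obtain ⟨K, hK⟩ := hM k
  refine ⟨K, fun q => ?_⟩
  obtain ⟨c, h1, h2, h3⟩ := hK q
  exact ⟨c, mem_recurrencePts_iff.2 h3, h1, h2⟩

theorem zero_mem_Sbeta (β : ℕ → ℕ) : 0 ∈ Sbeta β := ⟨0, by simp⟩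

/-- If `β` repeats its first `p` values from `l` on, then `S_β` repeats its first window at the
`l`-th element. -/
theorem sum_mem_recurrencePts {β : ℕ → ℕ} {l p : ℕ} (h : ∀ i < p, β (l + i) = β i) :
    ∑ i ∈ Finset.range l, (1 + β i) ∈ recurrencePts (Sbeta β) p := by
  have hmono : StrictMono fun l => ∑ i ∈ Finset.range l, (1 + β i) :=
    strictMono_nat_of_lt_succ fun n => by simp only [Finset.sum_range_succ]; omega
  have hsum : ∀ j ≤ p, ∑ i ∈ Finset.range (l + j), (1 + β i) =
      ∑ i ∈ Finset.range l, (1 + β i) + ∑ i ∈ Finset.range j, (1 + β i) := by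
    intro j hj
    rw [Finset.sum_range_add]
    congr 1
    refine Finset.sum_congr rfl fun i hi => ?_
    rw [h i (by have := Finset.mem_range.1 hi; omega)]
  intro m hm
  constructor
  · rintro ⟨j, hj⟩
    have : j ≤ ∑ i ∈ Finset.range j, (1 + β i) := hmono.id_le j
    exact ⟨l + j, by rw [hsum j (by omega), hj]⟩
  · rintro ⟨l', hl'⟩
    have hle : l ≤ l' := hmono.le_iff_le.1 (show
      ∑ i ∈ Finset.range l, (1 + β i) ≤ ∑ i ∈ Finset.range l', (1 + β i) by omega)
    obtain ⟨j, rfl⟩ := Nat.exists_eq_add_of_le hle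
    have hj : j ≤ p := by
      by_contra! hlt
      have h1 : ∑ i ∈ Finset.range (l + p), (1 + β i) < ∑ i ∈ Finset.range (l + j), (1 + β i) :=
        hmono (by omega)
      have h2 : p ≤ ∑ i ∈ Finset.range p, (1 + β i) := hmono.id_le p
      rw [hsum p le_rfl] at h1
      omega
    rw [hsum j hj] at hl'
    exact ⟨j, by omega⟩

theorem betaSeq_le_one (α : Cantor) (i : ℕ) : betaSeq α i ≤ 1 := by
  unfold betaSeq; split_ifs <;> simp

theorem betaSeq_mul_two_pow_add (α : Cantor) {p i : ℕ} (h : i < p) (j : ℕ) :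
    betaSeq α (2 ^ p * j + i) = betaSeq α i := by
  have hv : (2 ^ p * j + i + 1).factorization 2 = (i + 1).factorization 2 := by
    have hlt : (i + 1).factorization 2 < p :=
      (Nat.factorization_lt 2 (Nat.succ_ne_zero i)).trans_le h
    have key : ∀ t, t ≤ p → (2 ^ t ∣ 2 ^ p * j + i + 1 ↔ 2 ^ t ∣ i + 1) := fun t ht => by
      rw [add_assoc]
      exact Nat.dvd_add_right (Dvd.dvd.mul_right (pow_dvd_pow 2 ht) j)
    apply le_antisymm
    · by_contra! hc
      have h1 : 2 ^ ((i + 1).factorization 2 + 1) ∣ 2 ^ p * j + i + 1 :=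
        (Nat.prime_two.pow_dvd_iff_le_factorization (by omega)).2 hc
      have h2 := (Nat.prime_two.pow_dvd_iff_le_factorization (by omega)).1
        ((key _ hlt).1 h1)
      omega
    · refine (Nat.prime_two.pow_dvd_iff_le_factorization (by omega)).1 ((key _ hlt.le).2 ?_)
      exact (Nat.prime_two.pow_dvd_iff_le_factorization (by omega)).2 le_rfl
  simp only [betaSeq, hv]

theorem condM_Sbeta_betaSeq (α : Cantor) : CondM (Sbeta (betaSeq α)) := by
  intro p
  refine ⟨2 * 2 ^ p, fun q => ?_⟩
  set σ : ℕ → ℕ := fun l => ∑ i ∈ Finset.range l, (1 + betaSeq α i) with hσ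
  have hmono : StrictMono σ :=
    strictMono_nat_of_lt_succ fun n => by simp only [hσ, Finset.sum_range_succ]; omega
  have hstep : ∀ l d, σ (l + d) ≤ σ l + 2 * d := by
    intro l d
    simp only [hσ, Finset.sum_range_add, add_le_add_iff_left]
    calc _ ≤ ∑ _i ∈ Finset.range d, 2 := Finset.sum_le_sum fun i _ => by
            have := betaSeq_le_one α (l + i); omega
      _ = 2 * d := by simp [mul_comm]
  have hex : ∃ j, q ≤ σ (2 ^ p * j) := ⟨q, by
    calc q ≤ 2 ^ p * q := Nat.le_mul_of_pos_left q (by positivity)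
      _ ≤ σ (2 ^ p * q) := hmono.id_le _⟩
  refine ⟨σ (2 ^ p * Nat.find hex), Nat.find_spec hex, ?_, mem_recurrencePts_iff.1
    (sum_mem_recurrencePts fun i hi => betaSeq_mul_two_pow_add α hi _)⟩
  rcases Nat.eq_zero_or_pos (Nat.find hex) with h | h
  · rw [h]; simp [hσ]
  · have h1 : σ (2 ^ p * (Nat.find hex - 1)) < q := not_le.1 (Nat.find_min hex (by omega))
    have h2 := hstep (2 ^ p * (Nat.find hex - 1)) (2 ^ p)
    rw [← Nat.mul_succ, Nat.succ_eq_add_one, Nat.sub_add_cancel h] at h2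
    omega

end CombinatoricsOfS

section Smallness

open MeasureTheory

instance : PolishSpace Cantor :=
  haveI : PolishSpace Bool := {}
  inferInstanceAs (PolishSpace (ℕ → Bool))

theorem cardOnes_congr {x y : Cantor} {n : ℕ} (h : ∀ i < n, x i = y i) :
    cardOnes x n = cardOnes y n :=
  Finset.sum_congr rfl fun i hi => by rw [h i (Finset.mem_range.1 hi)]

theorem continuous_cardOnes (n : ℕ) : Continuous fun x => cardOnes x n := by
  refine continuous_finsetSum _ fun i _ => ?_
  exact (continuous_of_discreteTopology (f := fun b : Bool => if b = true then 1 else 0)).comp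
    (continuous_apply i)

theorem continuous_fSfun (n : ℕ) : Continuous (fSfun n) :=
  continuous_id.update n continuous_const

theorem isClopen_DSdom (T : Set ℕ) (n : ℕ) : IsClopen (DSdom T n) := by
  have h1 : IsClopen {x : Cantor | x n = false} :=
    (isClopen_discrete {false}).preimage (continuous_apply n)
  have h2 : IsClopen {x : Cantor | cardOnes x n ∈ T} :=
    (isClopen_discrete T).preimage (continuous_cardOnes n)
  exact h1.inter h2

theorem analyticSet_inter_clopen {P D : Set Cantor} (hP : AnalyticSet P) (hD : IsClopen D) :
    AnalyticSet (P ∩ D) := by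
  rw [inter_eq_iInter]
  exact AnalyticSet.iInter (Bool.forall_bool.2 ⟨hD.isClosed.analyticSet, hP⟩)

/-- `P` contains no pair `(x, f^T_n(x))` with `n ≥ N`. -/
def FlipFree (T : Set ℕ) (N : ℕ) (P : Set Cantor) : Prop :=
  ∀ n ≥ N, ∀ x ∈ P, x ∈ DSdom T n → fSfun n x ∉ P

/-- `P` is covered by countably many Borel sets containing no pair in `A^S`. -/
def FlipSmall (S : Set ℕ) (P : Set Cantor) : Prop :=
  ∃ B : ℕ → Set Cantor, (∀ i, MeasurableSet (B i) ∧ FlipFree S 0 (B i)) ∧ P ⊆ ⋃ i, B i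

theorem FlipFree.mono {T : Set ℕ} {N : ℕ} {P Q : Set Cantor} (h : FlipFree T N Q) (hPQ : P ⊆ Q) :
    FlipFree T N P :=
  fun n hn x hx hD hf => h n hn x (hPQ hx) hD (hPQ hf)

theorem FlipSmall.mono {S : Set ℕ} {P Q : Set Cantor} (h : FlipSmall S Q) (hPQ : P ⊆ Q) : FlipSmall S P := by
  obtain ⟨B, hB, hQ⟩ := h
  exact ⟨B, hB, hPQ.trans hQ⟩

theorem FlipSmall.iUnion {S : Set ℕ} {ι : Type*} [Countable ι] {P : ι → Set Cantor}
    (h : ∀ i, FlipSmall S (P i)) : FlipSmall S (⋃ i, P i) := by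
  rcases isEmpty_or_nonempty ι with hι | hι
  · exact ⟨fun _ => ∅, fun _ => ⟨MeasurableSet.empty, fun _ _ _ hx => hx.elim⟩, by simp⟩
  choose B hB hP using h
  obtain ⟨e, he⟩ := exists_surjective_nat (ι × ℕ)
  refine ⟨fun j => B (e j).1 (e j).2, fun j => hB _ _, iUnion_subset fun i x hx => ?_⟩
  obtain ⟨j, hj⟩ := mem_iUnion.1 (hP i hx)
  obtain ⟨k, hk⟩ := he (i, j)
  exact mem_iUnion.2 ⟨k, by rwa [hk]⟩

theorem flipSmall_of_flipFree {S : Set ℕ} {B : Set Cantor} (hB : MeasurableSet B)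
    (h : FlipFree S 0 B) : FlipSmall S B :=
  ⟨fun _ => B, fun _ => ⟨hB, h⟩, fun _ hx => mem_iUnion.2 ⟨0, hx⟩⟩

theorem flipSmall_union {S : Set ℕ} {P Q : Set Cantor} (hP : FlipSmall S P) (hQ : FlipSmall S Q) :
    FlipSmall S (P ∪ Q) := by
  rw [union_eq_iUnion]
  exact FlipSmall.iUnion (Bool.forall_bool.2 ⟨hQ, hP⟩)

/-- Only finitely many patterns occur below `N`, so flips of large coordinates suffice. -/
theorem flipSmall_of_flipFree_ge {S : Set ℕ} {B : Set Cantor} {N : ℕ} (hB : MeasurableSet B)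
    (h : FlipFree S N B) : FlipSmall S B := by
  have hcov : B ⊆ ⋃ t : Fin N → Bool, B ∩ {x | ∀ i : Fin N, x i = t i} :=
    fun x hx => mem_iUnion.2 ⟨fun i => x i, hx, fun _ => rfl⟩
  refine (FlipSmall.iUnion fun t => flipSmall_of_flipFree ?_ ?_).mono hcov
  · refine hB.inter ?_
    rw [ofPred_forall]
    exact MeasurableSet.iInter fun i =>
      measurableSet_eq_fun (measurable_pi_apply _) measurable_const
  · intro n _ x hx hD hf
    rcases le_or_gt N n with hn | hn
    · exact h n hn x hx.1 hD hf.1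
    · have h1 := hx.2 ⟨n, hn⟩
      have h2 := hf.2 ⟨n, hn⟩
      simp only [fSfun, Function.update_self] at h2
      have h3 : x n = false := hD.1
      simp_all

theorem exists_measurable_flipFree {T : Set ℕ} {N : ℕ} {P : Set Cantor}
    (hP : AnalyticSet P) (h : FlipFree T N P) :
    ∃ B, P ⊆ B ∧ MeasurableSet B ∧ FlipFree T N B := by
  have hQ : AnalyticSet (⋃ n : {n // N ≤ n}, fSfun n '' (P ∩ DSdom T n)) :=
    AnalyticSet.iUnion fun n =>
      (analyticSet_inter_clopen hP (isClopen_DSdom T n)).image_of_continuous (continuous_fSfun n)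
  obtain ⟨B, hPB, hQB, hB⟩ := hP.measurablySeparable hQ (by
    rw [Set.disjoint_left]
    intro y hy hyQ
    obtain ⟨⟨n, hn⟩, x, ⟨hx, hD⟩, rfl⟩ := mem_iUnion.1 hyQ
    exact h n hn x hx hD hy)
  refine ⟨B \ ⋃ n : {n // N ≤ n}, (DSdom T n ∩ fSfun n ⁻¹' B), ?_, ?_, ?_⟩
  · refine fun x hx => ⟨hPB hx, fun hx' => ?_⟩
    obtain ⟨n, hD, hf⟩ := mem_iUnion.1 hx'
    exact Set.disjoint_left.1 hQB (mem_iUnion.2 ⟨n, x, ⟨hx, hD⟩, rfl⟩) hf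
  · exact hB.diff (MeasurableSet.iUnion fun n =>
      (isClopen_DSdom T n).isOpen.measurableSet.inter ((continuous_fSfun n).measurable hB))
  · intro n hn x hx hD hf
    exact hx.2 (mem_iUnion.2 ⟨⟨n, hn⟩, hD, hf.1⟩)

/-- The points of `P` whose `n`-th coordinate can be flipped inside `P`, with exactly `c` ones
before `n`. -/
def flipPart (P : Set Cantor) (n c : ℕ) : Set Cantor :=
  (P ∩ DSdom {c} n) ∩ fSfun n ⁻¹' P

theorem analyticSet_flipPart {P : Set Cantor} (hP : AnalyticSet P) (n c : ℕ) :
    AnalyticSet (flipPart P n c) := by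
  have h1 := analyticSet_inter_clopen hP (isClopen_DSdom {c} n)
  have h2 := hP.preimage (continuous_fSfun n)
  rw [flipPart, inter_eq_iInter]
  exact AnalyticSet.iInter (Bool.forall_bool.2 ⟨h2, h1⟩)

theorem measurableSet_flipPart {P : Set Cantor} (hP : MeasurableSet P) (n c : ℕ) :
    MeasurableSet (flipPart P n c) :=
  (hP.inter (isClopen_DSdom {c} n).isOpen.measurableSet).inter ((continuous_fSfun n).measurable hP)

theorem exists_flipPart_not_flipSmall {S T : Set ℕ} {N : ℕ}
    (hT : ∀ B, MeasurableSet B → FlipFree T N B → FlipSmall S B)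
    {P : Set Cantor} (hP : AnalyticSet P) (hns : ¬ FlipSmall S P) :
    ∃ n ≥ N, ∃ c ∈ T, ¬ FlipSmall S (flipPart P n c) := by
  by_contra! hcon
  have hsm : FlipSmall S (⋃ i : {n // N ≤ n} × T, flipPart P i.1 i.2) :=
    FlipSmall.iUnion fun i => hcon i.1 i.1.2 i.2 i.2.2
  obtain ⟨B, hB, hcov⟩ := hsm
  have hBm : MeasurableSet (⋃ i, B i) := MeasurableSet.iUnion fun i => (hB i).1
  have hA : AnalyticSet (P ∩ (⋃ i, B i)ᶜ) := by
    rw [inter_eq_iInter]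
    exact AnalyticSet.iInter (Bool.forall_bool.2 ⟨hBm.compl.analyticSet, hP⟩)
  have hfree : FlipFree T N (P ∩ (⋃ i, B i)ᶜ) := fun n hn x hx hD hf =>
    hx.2 (hcov (mem_iUnion.2
      ⟨(⟨n, hn⟩, ⟨cardOnes x n, hD.2⟩), ⟨hx.1, hD.1, rfl⟩, hf.1⟩))
  obtain ⟨B', hPB', hB'm, hB'⟩ := exists_measurable_flipFree hA hfree
  refine hns ((flipSmall_union (hT B' hB'm hB') (FlipSmall.mono (Q := ⋃ i, B i) ⟨B, hB, subset_rfl⟩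
    subset_rfl)).mono fun x hx => ?_)
  by_cases hxB : x ∈ ⋃ i, B i
  · exact Or.inr hxB
  · exact Or.inl (hPB' ⟨hx, hxB⟩)

/-- A non-small Borel set contains arbitrarily long sequences of consecutive flips: a point `x`
flippable at a coordinate `n` with all the numbers of ones in an interval of given length. -/
theorem exists_flips_of_not_flipSmall {S : Set ℕ} (N K : ℕ) {B : Set Cantor} (hB : MeasurableSet B)
    (hns : ¬ FlipSmall S B) :
    ∃ B' ⊆ B, MeasurableSet B' ∧ ¬ FlipSmall S B' ∧ ∃ b ≥ N, ∀ x ∈ B', ∀ j ≤ K, ∃ y ∈ B,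
      (∀ n ≥ b, cardOnes y n = cardOnes x n + j) ∧ (∀ n ≥ b, y n = x n) ∧
      (∀ n ≥ b, fSfun n x ∈ B' → fSfun n y ∈ B) := by
  induction K generalizing B N with
  | zero =>
    exact ⟨B, subset_rfl, hB, hns, N, le_rfl, fun x hx j hj => ⟨x, hx, by simp; omega,
      fun _ _ => rfl, fun _ _ h => h⟩⟩
  | succ K ih =>
    obtain ⟨n, hn, c, -, hnc⟩ := exists_flipPart_not_flipSmall (S := S) (T := S) (N := N)
      (fun B hB h => flipSmall_of_flipFree_ge hB h) hB.analyticSet hns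
    obtain ⟨B', hB'B, hB'm, hB'ns, b, hb, hx⟩ :=
      ih (n + 1) (measurableSet_flipPart hB n c) hnc
    have hsub : flipPart B n c ⊆ B := fun x hx => hx.1.1
    refine ⟨B', hB'B.trans hsub, hB'm, hB'ns, b, by omega, fun x hxB j hj => ?_⟩
    rcases Nat.eq_zero_or_pos j with rfl | hj0
    · exact ⟨x, hsub (hB'B hxB), fun _ _ => rfl, fun _ _ => rfl, fun _ _ h => hsub (hB'B h)⟩
    obtain ⟨y, hy, h1, h2, h3⟩ := hx x hxB (j - 1) (by omega)
    refine ⟨fSfun n y, hy.2, fun m hm => ?_, fun m hm => ?_, fun m hm hf => ?_⟩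
    · have hyn : y n = false := hy.1.2.1
      have hnm : n ∈ Finset.range m := Finset.mem_range.2 (by omega)
      have := h1 m hm
      have e : cardOnes (fSfun n y) m = cardOnes y m + 1 := by
        unfold cardOnes
        rw [← Finset.add_sum_erase _ _ hnm, ← Finset.add_sum_erase _ (fun i => if y i = true
          then 1 else 0) hnm]
        have : ∑ i ∈ (Finset.range m).erase n, (if fSfun n y i = true then 1 else 0) =
            ∑ i ∈ (Finset.range m).erase n, (if y i = true then 1 else 0) :=
          Finset.sum_congr rfl fun i hi => by
            rw [fSfun, Function.update_of_ne (Finset.ne_of_mem_erase hi)]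
        rw [this]
        simp [fSfun, hyn]
        omega
      omega
    · rw [fSfun, Function.update_of_ne (by omega), h2 m hm]
    · have hcomm : fSfun m (fSfun n y) = fSfun n (fSfun m y) :=
        Function.update_comm (by omega) _ _ _
      rw [hcomm]
      exact (h3 m hm hf).2

/-- Under condition (M), avoiding the flips occurring at recurrence points forces smallness. -/
theorem flipSmall_of_flipFree_recurrencePts {S : Set ℕ} (hM : CondM S) (k N : ℕ) {B : Set Cantor}
    (hB : MeasurableSet B) (h : FlipFree (recurrencePts S k) N B) : FlipSmall S B := by
  by_contra hns
  obtain ⟨K, hK⟩ := hM.exists_recurrence k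
  obtain ⟨B', hB'B, hB'm, hB'ns, b, hb, hx⟩ := exists_flips_of_not_flipSmall N K hB hns
  have : ¬ FlipFree S b B' := fun hf => hB'ns (flipSmall_of_flipFree_ge hB'm hf)
  unfold FlipFree at this
  push Not at this
  obtain ⟨n, hn, x, hxB, hD, hf⟩ := this
  obtain ⟨c, hc, h1, h2⟩ := hK (cardOnes x n)
  obtain ⟨y, hy, e1, e2, e3⟩ := hx x hxB (c - cardOnes x n) (by omega)
  refine h n (by omega) y hy ⟨by rw [e2 n hn]; exact hD.1, ?_⟩ (e3 n hn hf)
  rw [e1 n hn, Nat.add_sub_cancel' h1]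
  exact hc

end Smallness

section Cubes

open MeasureTheory Filter

/-- Set all the coordinates in `M` to one. -/
def flipOn (M : Finset ℕ) (y : Cantor) : Cantor := fun j => y j || decide (j ∈ M)

theorem continuous_flipOn (M : Finset ℕ) : Continuous (flipOn M) :=
  continuous_pi fun j =>
    (continuous_of_discreteTopology (f := fun b : Bool => b || decide (j ∈ M))).comp
      (continuous_apply j)

theorem flipOn_insert (n : ℕ) (M : Finset ℕ) (y : Cantor) :
    flipOn (insert n M) y = flipOn M (fSfun n y) := by
  funext j
  by_cases h : j = n
  · subst h; simp [flipOn, fSfun]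
  · simp [flipOn, fSfun, h]

variable {Z : Type} [MetricSpace Z]

/-- A finite stage of the construction of a copy of the infinite cube: `F` is the set of the
coordinates chosen so far, all below `b`, and each `y ∈ P` is the bottom vertex of a cube in the
directions `F` whose vertex `flipOn M y` lifts to `U M`. -/
structure CubeStage (S : Set ℕ) (π : Z → Cantor) where
  P : Set Cantor
  F : Finset ℕ
  b : ℕ
  U : Finset ℕ → Set Z
  analytic : AnalyticSet P
  not_flipSmall : ¬ FlipSmall S P
  lt_b : ∀ m ∈ F, m < b
  isClosed_U : ∀ M, IsClosed (U M)
  lift : ∀ y ∈ P, ∀ M ⊆ F, flipOn M y ∈ π '' U M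

theorem FlipSmall.empty (S : Set ℕ) : FlipSmall S ∅ :=
  flipSmall_of_flipFree MeasurableSet.empty fun _ _ _ hx => hx.elim

theorem nonempty_of_not_flipSmall {S : Set ℕ} {P : Set Cantor} (h : ¬ FlipSmall S P) :
    P.Nonempty := by
  rw [nonempty_iff_ne_empty]
  rintro rfl
  exact h (FlipSmall.empty S)

theorem exists_shrink [PolishSpace Z] {S : Set ℕ} {π : Z → Cantor} (hπ : Continuous π)
    {P : Set Cantor} (hP : AnalyticSet P) (hns : ¬ FlipSmall S P) (F : Finset (Finset ℕ))
    {U : Finset ℕ → Set Z} (hU : ∀ M, IsClosed (U M))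
    (hlift : ∀ y ∈ P, ∀ M ∈ F, flipOn M y ∈ π '' U M) {r : ℝ} (hr : 0 < r) :
    ∃ P' ⊆ P, AnalyticSet P' ∧ ¬ FlipSmall S P' ∧ ∃ U' : Finset ℕ → Set Z,
      (∀ M, IsClosed (U' M)) ∧ (∀ M, U' M ⊆ U M) ∧
      (∀ y ∈ P', ∀ M ∈ F, flipOn M y ∈ π '' U' M) ∧
      ∀ M ∈ F, ∀ z ∈ U' M, ∀ z' ∈ U' M, dist z z' ≤ r := by
  classical
  rcases isEmpty_or_nonempty Z with hZ | hZ
  · refine ⟨P, subset_rfl, hP, hns, U, hU, fun _ => subset_rfl, hlift, fun _ _ z => ?_⟩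
    exact (hZ.false z).elim
  set d := TopologicalSpace.denseSeq Z
  let V : (F → ℕ) → F → Set Z := fun i M => U M ∩ Metric.closedBall (d (i M)) (r / 2)
  have hV : ∀ i M, IsClosed (V i M) := fun i M => (hU M).inter Metric.isClosed_closedBall
  let Q : (F → ℕ) → Set Cantor := fun i =>
    ⋂ o : Option F, o.elim P fun M => flipOn M ⁻¹' (π '' V i M)
  have hQmem : ∀ i y, y ∈ Q i ↔ y ∈ P ∧ ∀ M : F, flipOn M y ∈ π '' V i M := by
    intro i y
    simp only [Q, mem_iInter, Option.forall, Option.elim, mem_preimage]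
  have hcov : P ⊆ ⋃ i, Q i := by
    intro y hy
    have : ∀ M : F, ∃ i : ℕ, flipOn M y ∈ π '' (U M ∩ Metric.closedBall (d i) (r / 2)) := by
      intro M
      obtain ⟨z, hz, hzy⟩ := hlift y hy M M.2
      obtain ⟨i, hi⟩ := (TopologicalSpace.denseRange_denseSeq Z).exists_dist_lt z
        (half_pos hr)
      exact ⟨i, z, ⟨hz, hi.le⟩, hzy⟩
    choose i hi using this
    exact mem_iUnion.2 ⟨i, (hQmem i y).2 ⟨hy, hi⟩⟩
  obtain ⟨i, hi⟩ : ∃ i, ¬ FlipSmall S (Q i) := by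
    by_contra! hcon
    exact hns ((FlipSmall.iUnion hcon).mono hcov)
  refine ⟨Q i, fun y hy => ((hQmem i y).1 hy).1, AnalyticSet.iInter ?_, hi,
    fun M => if h : M ∈ F then V i ⟨M, h⟩ else ∅, ?_, ?_, ?_, ?_⟩
  · rintro (_ | M)
    · exact hP
    · exact ((hV i M).analyticSet.image_of_continuous hπ).preimage (continuous_flipOn M)
  · intro M
    by_cases h : M ∈ F
    · simpa [h] using hV i ⟨M, h⟩
    · simp [h]
  · intro M
    by_cases h : M ∈ F
    · simp [h, V]
    · simp [h]
  · intro y hy M hM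
    simpa only [hM, dif_pos] using ((hQmem i y).1 hy).2 ⟨M, hM⟩
  · intro M hM z hz z' hz'
    simp only [hM, dif_pos] at hz hz'
    have h1 := Metric.mem_closedBall.1 hz.2
    have h2 := Metric.mem_closedBall'.1 hz'.2
    linarith [dist_triangle z (d (i ⟨M, hM⟩)) z']

theorem CubeStage.exists_next [PolishSpace Z] {S : Set ℕ} (hM : CondM S) {π : Z → Cantor}
    (hπ : Continuous π) (k : ℕ) (s : CubeStage S π) :
    ∃ s' : CubeStage S π, ∃ n ≥ s.b, s'.F = insert n s.F ∧ s'.b = n + 1 ∧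
      s'.P ⊆ s.P ∩ DSdom (recurrencePts S k) n ∧
      (∀ M ⊆ s.F, s'.U M ⊆ s.U M ∧ s'.U (insert n M) ⊆ s.U M) ∧
      ∀ M ⊆ s'.F, ∀ z ∈ s'.U M, ∀ z' ∈ s'.U M, dist z z' ≤ 1 * (1 / 2 : ℝ) ^ k := by
  classical
  obtain ⟨n, hn, c, hc, hns⟩ := exists_flipPart_not_flipSmall (S := S) (N := s.b)
    (fun B hB h => flipSmall_of_flipFree_recurrencePts hM k s.b hB h) s.analytic s.not_flipSmall
  have hnF : n ∉ s.F := fun h => absurd (s.lt_b n h) (by omega)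
  let U : Finset ℕ → Set Z := fun M => s.U (M.erase n)
  have hlift : ∀ y ∈ flipPart s.P n c, ∀ M ∈ (insert n s.F).powerset,
      flipOn M y ∈ π '' U M := by
    intro y hy M hM
    have hsub : M.erase n ⊆ s.F := Finset.subset_insert_iff.1 (Finset.mem_powerset.1 hM)
    by_cases h : n ∈ M
    · have := s.lift _ hy.2 _ hsub
      rwa [← flipOn_insert, Finset.insert_erase h] at this
    · have := s.lift _ hy.1.1 _ hsub
      simpa only [U, Finset.erase_eq_of_notMem h] using this
  obtain ⟨P', hP'P, hP', hP'ns, U', hU', hU'U, hlift', hdiam⟩ :=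
    exists_shrink hπ (analyticSet_flipPart s.analytic n c) hns (insert n s.F).powerset
      (U := U) (fun M => s.isClosed_U _) hlift (r := 1 * (1 / 2 : ℝ) ^ k) (by positivity)
  refine ⟨⟨P', insert n s.F, n + 1, U', hP', hP'ns, ?_, hU', fun y hy M hM =>
    hlift' y hy M (Finset.mem_powerset.2 hM)⟩, n, hn, rfl, rfl, ?_, ?_, fun M hM =>
    hdiam M (Finset.mem_powerset.2 hM)⟩
  · intro m hm
    rcases Finset.mem_insert.1 hm with rfl | hm
    · omega
    · have := s.lt_b m hm; omega
  · intro y hy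
    have h := hP'P hy
    refine ⟨h.1.1, h.1.2.1, ?_⟩
    have : cardOnes y n = c := h.1.2.2
    rwa [this]
  · intro M hM
    have hnM : n ∉ M := fun h => hnF (hM h)
    constructor
    · have := hU'U M
      simpa only [U, Finset.erase_eq_of_notMem hnM] using this
    · have := hU'U (insert n M)
      simpa only [U, Finset.erase_insert hnM] using this

theorem exists_cube [CompleteSpace Z] [PolishSpace Z] {S : Set ℕ} (hM : CondM S)
    {π : Z → Cantor} (hπ : Continuous π) (hns : ¬ FlipSmall S (range π)) :
    ∃ w : Cantor → Z, Continuous w ∧ ∃ (n : ℕ → ℕ) (y : Cantor), StrictMono n ∧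
      (∀ i, y ∈ DSdom (recurrencePts S i) (n i)) ∧
      ∀ x j, π (w x) j = true ↔ (y j = true ∨ ∃ i, n i = j ∧ x i = true) := by
  classical
  choose next n₀ hb hF hb' hP hU hdiam using
    fun k (s : CubeStage S π) => CubeStage.exists_next hM hπ k s
  let s₀ : CubeStage S π := ⟨range π, ∅, 0, fun _ => univ,
    analyticSet_range_of_polishSpace hπ, hns, by simp, fun _ => isClosed_univ, by
      rintro _ ⟨z, rfl⟩ M hM
      rw [Finset.subset_empty.1 hM]
      exact ⟨z, mem_univ z, by funext j; simp [flipOn]⟩⟩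
  let st : ℕ → CubeStage S π := fun k => Nat.rec s₀ next k
  let n : ℕ → ℕ := fun k => n₀ k (st k)
  have hn : StrictMono n := strictMono_nat_of_lt_succ fun k => by
    have h1 : (st (k + 1)).b ≤ n (k + 1) := hb (k + 1) (st (k + 1))
    have h2 : (st (k + 1)).b = n k + 1 := hb' k (st k)
    omega
  let M : ℕ → Cantor → Finset ℕ := fun k x =>
    ((Finset.range k).filter fun i => x i = true).image n
  have hMF : ∀ k x, M k x ⊆ (st k).F := by
    intro k x
    induction k with
    | zero => simp [M]
    | succ k ih =>
      have h1 : (st (k + 1)).F = insert (n k) (st k).F := hF k (st k)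
      rw [h1]
      simp only [M, Finset.range_add_one, Finset.filter_insert]
      split_ifs
      · rw [Finset.image_insert]; exact Finset.insert_subset_insert _ ih
      · exact ih.trans (Finset.subset_insert _ _)
  have hUU : ∀ k x, (st (k + 1)).U (M (k + 1) x) ⊆ (st k).U (M k x) := by
    intro k x
    have h1 := hU k (st k) (M k x) (hMF k x)
    simp only [M, Finset.range_add_one, Finset.filter_insert]
    split_ifs
    · rw [Finset.image_insert]; exact h1.2
    · exact h1.1
  have hUanti : ∀ x, Antitone fun k => (st k).U (M k x) := fun x =>
    antitone_nat_of_succ_le fun k => hUU k x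
  have hPanti : Antitone fun k => (st k).P :=
    antitone_nat_of_succ_le fun k => (hP k (st k)).trans inter_subset_left
  choose yk hyk using fun k => nonempty_of_not_flipSmall (st k).not_flipSmall
  choose z hzU hzy using fun k x => (st k).lift (yk k) (hyk k) (M k x) (hMF k x)
  have hcauchy : ∀ x, CauchySeq fun k => z (k + 1) x := fun x =>
    cauchySeq_of_le_geometric (1 / 2) 1 (by norm_num) fun k =>
      hdiam k (st k) (M (k + 1) x) (hMF (k + 1) x) _ (hzU (k + 1) x) _
        (hUU (k + 1) x (hzU (k + 2) x))
  choose w hw using fun x => cauchySeq_tendsto_of_complete (hcauchy x)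
  have hw' : ∀ x, Tendsto (fun k => z k x) atTop (𝓝 (w x)) := fun x =>
    (tendsto_add_atTop_iff_nat (f := fun k => z k x) 1).1 (hw x)
  have hwU : ∀ k x, w x ∈ (st k).U (M k x) := fun k x =>
    ((st k).isClosed_U _).mem_of_tendsto (hw' x)
      (eventually_atTop.2 ⟨k, fun l hl => hUanti x hl (hzU l x)⟩)
  have hlim : ∀ x, Tendsto (fun k => flipOn (M k x) (yk k)) atTop (𝓝 (π (w x))) := fun x => by
    have := (hπ.tendsto (w x)).comp (hw' x)
    simpa only [Function.comp_def, hzy] using this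
  set y : Cantor := π (w fun _ => false) with hy
  have hylim : Tendsto yk atTop (𝓝 y) := by
    have h0 : ∀ k, flipOn (M k fun _ => false) (yk k) = yk k := fun k => by
      funext j; simp [flipOn, M]
    simpa only [h0] using hlim fun _ => false
  refine ⟨w, ?_, n, y, hn, fun i => ?_, fun x j => ?_⟩
  · rw [continuous_iff_continuousAt]
    intro x
    rw [ContinuousAt, Metric.tendsto_nhds]
    intro ε hε
    obtain ⟨k, hk⟩ := exists_pow_lt_of_lt_one hε (by norm_num : (1 / 2 : ℝ) < 1)
    have hnear : ∀ᶠ x' : Cantor in 𝓝 x, ∀ i ∈ Finset.range (k + 1), x' i = x i := by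
      rw [Finset.eventually_all]
      intro i _
      exact ((isOpen_discrete {x i}).preimage
        (continuous_apply (A := fun _ : ℕ => Bool) i)).mem_nhds rfl
    filter_upwards [hnear] with x' hx'
    have hMeq : M (k + 1) x' = M (k + 1) x := by
      simp only [M]
      congr 1
      exact Finset.filter_congr fun i hi => by rw [hx' i hi]
    have h1 := hdiam k (st k) (M (k + 1) x) (hMF (k + 1) x) (w x')
      (by rw [← hMeq]; exact hwU (k + 1) x') (w x) (hwU (k + 1) x)
    linarith
  · refine (isClopen_DSdom _ (n i)).isClosed.mem_of_tendsto hylim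
      (eventually_atTop.2 ⟨i + 1, fun l hl => ?_⟩)
    exact (hP i (st i) (hPanti hl (hyk l))).2
  · have h1 := (tendsto_pi_nhds.1 (hlim x)) j
    have h2 := (tendsto_pi_nhds.1 hylim) j
    rw [nhds_discrete, tendsto_pure] at h1 h2
    obtain ⟨k, e1, e2, e3⟩ := (h1.and (h2.and (eventually_gt_atTop j))).exists
    rw [← e1, ← e2]
    simp only [flipOn, Bool.or_eq_true, decide_eq_true_eq, M, Finset.mem_image,
      Finset.mem_filter, Finset.mem_range]
    refine or_congr_right ⟨?_, ?_⟩
    · rintro ⟨i, ⟨-, hx⟩, hi⟩; exact ⟨i, hi, hx⟩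
    · rintro ⟨i, hi, hx⟩
      have := hn.id_le i
      exact ⟨i, ⟨by simp only [id] at this; omega, hx⟩, hi⟩

end Cubes

theorem mem_ASet_iff {S : Set ℕ} {x x' : Cantor} :
    (x, x') ∈ ASet S ↔ ∃ n, x ∈ DSdom S n ∧ x' = fSfun n x := by
  simp [ASet, unionGraphs, graphRel]

theorem cardOnes_le (x : Cantor) (n : ℕ) : cardOnes x n ≤ n := by
  calc cardOnes x n ≤ ∑ _i ∈ Finset.range n, 1 :=
        Finset.sum_le_sum fun i _ => by split_ifs <;> simp
    _ = n := by simp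

/-- A cube whose directions are chosen at recurrence points reduces `A^S` to itself. -/
theorem mem_ASet_cube_iff {S : Set ℕ} {n : ℕ → ℕ} {y : Cantor} {a : Cantor → Cantor}
    (hn : StrictMono n) (hy : ∀ i, y ∈ DSdom (recurrencePts S i) (n i))
    (ha : ∀ x j, a x j = true ↔ (y j = true ∨ ∃ i, n i = j ∧ x i = true)) (x x' : Cantor) :
    (a x, a x') ∈ ASet S ↔ (x, x') ∈ ASet S := by
  classical
  have hyn : ∀ i, y (n i) = false := fun i => (hy i).1
  have han : ∀ x i, a x (n i) = x i := by
    intro x i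
    rw [Bool.eq_iff_iff, ha]
    simp only [hyn, Bool.false_eq_true, false_or]
    exact ⟨fun ⟨i', h1, h2⟩ => hn.injective h1 ▸ h2, fun h => ⟨i, rfl, h⟩⟩
  have hanot : ∀ x j, (∀ i, n i ≠ j) → a x j = y j := by
    intro x j hj
    rw [Bool.eq_iff_iff, ha]
    exact ⟨fun h => h.resolve_right fun ⟨i, h1, _⟩ => hj i h1, Or.inl⟩
  have hcard : ∀ x k, cardOnes (a x) (n k) = cardOnes y (n k) + cardOnes x k := by
    intro x k
    have h1 : cardOnes x k =
        ∑ j ∈ Finset.range (n k), if ∃ i, n i = j ∧ x i = true then 1 else 0 := by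
      rw [cardOnes, ← Finset.card_filter, ← Finset.card_filter,
        ← Finset.card_image_of_injective _ hn.injective]
      congr 1
      ext j
      simp only [Finset.mem_image, Finset.mem_filter, Finset.mem_range]
      constructor
      · rintro ⟨i, ⟨hi, hx⟩, rfl⟩
        exact ⟨hn hi, i, rfl, hx⟩
      · rintro ⟨hj, i, rfl, hx⟩
        exact ⟨i, ⟨hn.lt_iff_lt.1 hj, hx⟩, rfl⟩
    rw [h1, cardOnes, cardOnes, ← Finset.sum_add_distrib]
    refine Finset.sum_congr rfl fun j _ => ?_
    by_cases hj : ∃ i, n i = j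
    · obtain ⟨i, rfl⟩ := hj
      have : (∃ i', n i' = n i ∧ x i' = true) ↔ x i = true :=
        ⟨fun ⟨i', h1, h2⟩ => hn.injective h1 ▸ h2, fun h => ⟨i, rfl, h⟩⟩
      simp [han, hyn, this]
    · push Not at hj
      have : ¬ ∃ i, n i = j ∧ x i = true := fun ⟨i, h, _⟩ => hj i h
      simp [hanot x j hj, this]
  have hS : ∀ x k, cardOnes (a x) (n k) ∈ S ↔ cardOnes x k ∈ S := fun x k => by
    rw [hcard]
    exact ((hy k).2 _ (cardOnes_le x k)).symm
  rw [mem_ASet_iff, mem_ASet_iff]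
  constructor
  · rintro ⟨m, ⟨hm, hmS⟩, he⟩
    obtain ⟨k, rfl⟩ : ∃ k, n k = m := by
      by_contra! hcon
      have h1 := congrFun he m
      simp [fSfun, hanot x' m hcon, ← hanot x m hcon, hm] at h1
    refine ⟨k, ⟨han x k ▸ hm, (hS x k).1 hmS⟩, funext fun i => ?_⟩
    have h1 := congrFun he (n i)
    rw [han] at h1
    rw [h1]
    by_cases hi : i = k
    · subst hi; simp [fSfun]
    · simp [fSfun, Function.update_of_ne hi, Function.update_of_ne (hn.injective.ne hi), han]
  · rintro ⟨k, ⟨hk, hkS⟩, rfl⟩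
    refine ⟨n k, ⟨by rw [han]; exact hk, (hS x k).2 hkS⟩, funext fun j => ?_⟩
    by_cases hj : ∃ i, n i = j
    · obtain ⟨i, rfl⟩ := hj
      rw [han]
      by_cases hi : i = k
      · subst hi; simp [fSfun]
      · simp [fSfun, Function.update_of_ne hi, Function.update_of_ne (hn.injective.ne hi), han]
    · push Not at hj
      rw [hanot _ _ hj, fSfun, Function.update_of_ne (hj k).symm, hanot _ _ hj]

section PotentiallyClosed

open MeasureTheory Filter

theorem cardOnes_succ (x : Cantor) (n : ℕ) :
    cardOnes x (n + 1) = cardOnes x n + if x n = true then 1 else 0 :=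
  Finset.sum_range_succ _ _

/-- `f_n` as an involution of the whole Cantor space. -/
def flipAt (n : ℕ) (x : Cantor) : Cantor := Function.update x n (!x n)

theorem flipAt_flipAt (n : ℕ) (x : Cantor) : flipAt n (flipAt n x) = x := by
  simp [flipAt]

theorem flipAt_eq_fSfun {n : ℕ} {x : Cantor} (h : x n = false) : flipAt n x = fSfun n x := by
  simp [flipAt, fSfun, h]

theorem continuous_flipAt (n : ℕ) : Continuous (flipAt n) :=
  continuous_id.update n
    ((continuous_of_discreteTopology (f := Bool.not)).comp (continuous_apply n))

theorem isOpenMap_flipAt (n : ℕ) : IsOpenMap (flipAt n) :=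
  (Homeomorph.mk ⟨flipAt n, flipAt n, flipAt_flipAt n, flipAt_flipAt n⟩ (continuous_flipAt n)
    (continuous_flipAt n)).isOpenMap

/-- Every nonempty open set contains a pair `(x, f^S_n(x))`. -/
theorem exists_flip_mem_of_isOpen {S : Set ℕ} (hS : ∀ q, ∃ c ∈ S, q ≤ c) {U : Set Cantor}
    (hU : IsOpen U) (hne : U.Nonempty) : ∃ n, ∃ x ∈ U, x ∈ DSdom S n ∧ fSfun n x ∈ U := by
  obtain ⟨x, hx⟩ := hne
  obtain ⟨I, u, hI, hIU⟩ := isOpen_pi_iff.1 hU x hx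
  obtain ⟨m, hm⟩ : ∃ m, ∀ i ∈ I, i < m := ⟨I.sup id + 1, fun i hi =>
    Nat.lt_succ_of_le (Finset.le_sup (f := id) hi)⟩
  have hmem : ∀ y : Cantor, (∀ i < m, y i = x i) → y ∈ U := fun y hy =>
    hIU fun i hi => by rw [hy i (hm i hi)]; exact (hI i hi).2
  obtain ⟨c, hc, hle⟩ := hS (cardOnes x m)
  set n := m + (c - cardOnes x m) with hn
  let y : Cantor := fun i => if i < m then x i else decide (i < n)
  have hym : ∀ i < m, y i = x i := fun i hi => by simp [y, hi]
  have hcard : ∀ d, m + d ≤ n → cardOnes y (m + d) = cardOnes x m + d := by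
    intro d
    induction d with
    | zero => intro _; exact cardOnes_congr hym
    | succ d ih =>
      intro hd
      have h1 : y (m + d) = true := by simp [y]; omega
      rw [← add_assoc, cardOnes_succ, ih (by omega), h1]
      simp; omega
  refine ⟨n, y, hmem y hym, ⟨by simp [y]; omega, ?_⟩, hmem _ fun i hi => ?_⟩
  · rw [hn, hcard _ le_rfl, Nat.add_sub_cancel' hle]
    exact hc
  · rw [fSfun, Function.update_of_ne (by omega), hym i hi]

theorem FlipFree.isMeagre {S : Set ℕ} (hS : ∀ q, ∃ c ∈ S, q ≤ c) {B : Set Cantor}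
    (hB : MeasurableSet B) (h : FlipFree S 0 B) : IsMeagre B := by
  obtain ⟨U, hU, hBU⟩ := hB.residualEq_isOpen
  rcases U.eq_empty_or_nonempty with rfl | hne
  · filter_upwards [hBU] with x hx hxB
    exact (eq_iff_iff.1 hx).1 hxB
  · obtain ⟨n, x, hxU, hxD, hfx⟩ := exists_flip_mem_of_isOpen hS hU hne
    have hW : {y | B y = U y} ∩ flipAt n ⁻¹' {y | B y = U y} ∈ residual Cantor :=
      inter_mem hBU (tendsto_residual_of_isOpenMap (continuous_flipAt n) (isOpenMap_flipAt n) hBU)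
    obtain ⟨y, ⟨⟨hyU, hyD⟩, hfy⟩, hy, hy'⟩ := (dense_of_mem_residual hW).inter_open_nonempty
      (U ∩ DSdom S n ∩ fSfun n ⁻¹' U)
      ((hU.inter (isClopen_DSdom S n).isOpen).inter (hU.preimage (continuous_fSfun n)))
      ⟨x, ⟨hxU, hxD⟩, hfx⟩
    rw [mem_preimage, flipAt_eq_fSfun hyD.1] at hy'
    exact (h n (Nat.zero_le n) y ((eq_iff_iff.1 hy).2 hyU) hyD ((eq_iff_iff.1 hy').2 hfy)).elim

theorem not_flipSmall_univ {S : Set ℕ} (hS : ∀ q, ∃ c ∈ S, q ≤ c) : ¬ FlipSmall S univ := by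
  rintro ⟨B, hB, hcov⟩
  have h : IsMeagre (univ : Set Cantor) :=
    (isMeagre_iUnion fun i => FlipFree.isMeagre hS (hB i).1 (hB i).2).mono hcov
  have h0 := dense_of_mem_residual h
  rw [compl_univ] at h0
  exact not_nonempty_empty h0.nonempty

theorem self_notMem_ASet {S : Set ℕ} (x : Cantor) : (x, x) ∉ ASet S := by
  rw [mem_ASet_iff]
  rintro ⟨n, ⟨hn, -⟩, he⟩
  have := congrFun he n
  simp [fSfun, hn] at this

theorem measurableSet_of_isOpen_finer {X : Type} [m : MeasurableSpace X] {t σ : TopologicalSpace X}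
    (hB : @BorelSpace X t m) (ht : @PolishSpace X t) (hσ : σ ≤ t) (hP : @PolishSpace X σ)
    {U : Set X} (hU : IsOpen[σ] U) : MeasurableSet U := by
  rw [@BorelSpace.measurable_eq X t m hB, ← @borel_eq_borel_of_le X σ t hP ht hσ]
  exact MeasurableSpace.measurableSet_generateFrom hU

theorem not_potClosed_ASet {S : Set ℕ} (hS : ∀ q, ∃ c ∈ S, q ≤ c) :
    ¬ PotClosed (inferInstanceAs (TopologicalSpace Cantor))
      (inferInstanceAs (TopologicalSpace Cantor)) (ASet S) := by
  have hborel : BorelSpace Cantor := inferInstance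
  have hC : PolishSpace Cantor := inferInstance
  rintro ⟨σ, τ, hσ, hτ, hσP, hτP, hcl⟩
  have hσc := @TopologicalSpace.exists_countable_basis Cantor σ hσP.toSecondCountableTopology
  have hτc := @TopologicalSpace.exists_countable_basis Cantor τ hτP.toSecondCountableTopology
  obtain ⟨b, hb, -, hbB⟩ := hσc
  obtain ⟨b', hb', -, hbB'⟩ := hτc
  have : Countable b := hb.to_subtype
  have : Countable b' := hb'.to_subtype
  let ι := {q : b × b' // ∀ x ∈ (q.1 : Set Cantor), ∀ y ∈ (q.2 : Set Cantor), (x, y) ∉ ASet S}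
  have hcov : univ ⊆ ⋃ q : ι, (q.1.1 : Set Cantor) ∩ q.1.2 := by
    intro x _
    obtain ⟨U, V, hU, hV, hxU, hxV, hUV⟩ := (@isOpen_prod_iff Cantor Cantor σ τ _).1
      (@IsClosed.isOpen_compl _ (@instTopologicalSpaceProd Cantor Cantor σ τ) _ hcl) x x
      (self_notMem_ASet x)
    obtain ⟨U', hU', hxU', hUU'⟩ := @TopologicalSpace.IsTopologicalBasis.exists_subset_of_mem_open
      _ σ _ hbB _ _ hxU hU
    obtain ⟨V', hV', hxV', hVV'⟩ := @TopologicalSpace.IsTopologicalBasis.exists_subset_of_mem_open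
      _ τ _ hbB' _ _ hxV hV
    exact mem_iUnion.2 ⟨⟨(⟨U', hU'⟩, ⟨V', hV'⟩), fun x hx y hy =>
      hUV ⟨hUU' hx, hVV' hy⟩⟩, hxU', hxV'⟩
  refine not_flipSmall_univ hS ((FlipSmall.iUnion fun q : ι => flipSmall_of_flipFree ?_ ?_).mono hcov)
  · exact (measurableSet_of_isOpen_finer hborel hC hσ hσP
      (@TopologicalSpace.IsTopologicalBasis.isOpen _ σ _ _ hbB q.1.1.2)).inter
      (measurableSet_of_isOpen_finer hborel hC hτ hτP
      (@TopologicalSpace.IsTopologicalBasis.isOpen _ τ _ _ hbB' q.1.2.2))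
  · exact fun n _ x hx hD hf => q.2 x hx.1 _ hf.2 (mem_ASet_iff.2 ⟨n, hD, rfl⟩)

theorem isClosed_ASet_union_diagonal (S : Set ℕ) : IsClosed (ASet S ∪ diagonal Cantor) := by
  have heq : ASet S ∪ diagonal Cantor =
      ⋂ m : ℕ, ((⋃ n ∈ Finset.range m, graphRel (DSdom S n) (fSfun n)) ∪
        {p | ∀ i < m, p.1 i = p.2 i}) := by
    ext ⟨x, y⟩
    simp only [mem_union, mem_diagonal_iff, mem_iInter, mem_iUnion, Finset.mem_range, mem_ofPred_eq,
      mem_ASet_iff, graphRel, exists_prop]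
    constructor
    · rintro (⟨n, hD, rfl⟩ | rfl) m
      · rcases lt_or_ge n m with h | h
        · exact Or.inl ⟨n, h, hD, rfl⟩
        · exact Or.inr fun i hi => by rw [fSfun, Function.update_of_ne (by omega)]
      · exact Or.inr fun _ _ => rfl
    · intro h
      by_cases hA : ∃ n, x ∈ DSdom S n ∧ y = fSfun n x
      · exact Or.inl hA
      · right
        funext i
        exact ((h (i + 1)).resolve_left fun ⟨n, _, h1⟩ => hA ⟨n, h1⟩) i (Nat.lt_succ_self i)
  rw [heq]
  refine isClosed_iInter fun m => IsClosed.union ?_ ?_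
  · refine isClosed_biUnion_finset fun n _ => ?_
    exact ((isClopen_DSdom S n).isClosed.preimage continuous_fst).inter
      (isClosed_eq continuous_snd ((continuous_fSfun n).comp continuous_fst))
  · simp only [ofPred_forall]
    exact isClosed_iInter fun i => isClosed_iInter fun _ =>
      isClosed_eq ((continuous_apply i).comp continuous_fst)
        ((continuous_apply i).comp continuous_snd)

theorem exists_polish_finer_isOpen {X : Type} [t : TopologicalSpace X] [PolishSpace X]
    {f : X → Cantor} (hf : Continuous f) {B : ℕ → Set Cantor} (hB : ∀ i, MeasurableSet (B i)) :
    ∃ σ ≤ t, @PolishSpace X σ ∧ ∀ i, IsOpen[σ] (f ⁻¹' B i) := by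
  borelize X
  choose m hm hmP _ hmo using fun i => (hf.measurable (hB i)).isClopenable
  obtain ⟨σ, h1, h2, h3⟩ := PolishSpace.exists_polishSpace_forall_le m hm hmP
  exact ⟨σ, h2, h3, fun i => h1 i _ (hmo i)⟩

/-- If the common values of `u` and `v` form a small set, then the preimage of `A^S` is
potentially closed. -/
theorem potClosed_preimage_of_flipSmall {S : Set ℕ} {X Y : Type} [tX : TopologicalSpace X]
    [PolishSpace X] [tY : TopologicalSpace Y] [PolishSpace Y] {u : X → Cantor} {v : Y → Cantor}
    (hu : Continuous u) (hv : Continuous v) (h : FlipSmall S (range u ∩ range v)) :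
    PotClosed tX tY ((fun p : X × Y => (u p.1, v p.2)) ⁻¹' ASet S) := by
  have hc1 : IsClosed ((fun p : X × Y => (u p.1, v p.2)) ⁻¹' (ASet S ∪ diagonal Cantor)) :=
    (isClosed_ASet_union_diagonal S).preimage
      ((hu.comp continuous_fst).prodMk (hv.comp continuous_snd))
  obtain ⟨B, hB, hcov⟩ := h
  obtain ⟨σ, hσ, hσP, hσB⟩ := exists_polish_finer_isOpen hu fun i => (hB i).1
  obtain ⟨τ, hτ, hτP, hτB⟩ := exists_polish_finer_isOpen hv fun i => (hB i).1
  refine ⟨σ, τ, hσ, hτ, hσP, hτP, ?_⟩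
  have heq : (fun p : X × Y => (u p.1, v p.2)) ⁻¹' ASet S =
      (fun p : X × Y => (u p.1, v p.2)) ⁻¹' (ASet S ∪ diagonal Cantor) ∩
        (⋃ i, (u ⁻¹' B i) ×ˢ (v ⁻¹' B i))ᶜ := by
    ext ⟨x, y⟩
    simp only [mem_preimage, mem_inter_iff, mem_union, mem_diagonal_iff, mem_compl_iff, mem_iUnion,
      mem_prod, not_exists]
    constructor
    · refine fun hA => ⟨Or.inl hA, fun i hi => ?_⟩
      obtain ⟨n, hD, he⟩ := mem_ASet_iff.1 hA
      exact (hB i).2 n (Nat.zero_le n) _ hi.1 hD (he ▸ hi.2)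
    · rintro ⟨hA | hd, hn⟩
      · exact hA
      · obtain ⟨i, hi⟩ := mem_iUnion.1 (hcov ⟨mem_range_self x, hd ▸ mem_range_self y⟩)
        exact (hn i ⟨hi, hd ▸ hi⟩).elim
  rw [heq]
  have hle : @instTopologicalSpaceProd X Y σ τ ≤ @instTopologicalSpaceProd X Y tX tY :=
    inf_le_inf (induced_mono hσ) (induced_mono hτ)
  have hc2 := hc1.mono hle
  have ho : @IsOpen _ (@instTopologicalSpaceProd X Y σ τ) (⋃ i, (u ⁻¹' B i) ×ˢ (v ⁻¹' B i)) :=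
    @isOpen_iUnion _ _ (@instTopologicalSpaceProd X Y σ τ) _ fun i =>
      @IsOpen.prod X Y σ τ _ _ (hσB i) (hτB i)
  exact @IsClosed.inter _ _ _ (@instTopologicalSpaceProd X Y σ τ) hc2
    (@IsOpen.isClosed_compl _ (@instTopologicalSpaceProd X Y σ τ) _ ho)

theorem minNonPotClosed_ASet {S : Set ℕ} (h0 : 0 ∈ S) (hM : CondM S) :
    MinNonPotClosed (inferInstanceAs (TopologicalSpace Cantor))
      (inferInstanceAs (TopologicalSpace Cantor)) (ASet S) := by
  have hS : ∀ q, ∃ c ∈ S, q ≤ c := fun q => by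
    obtain ⟨K, hK⟩ := hM.exists_recurrence 0
    obtain ⟨c, hc, hq, -⟩ := hK q
    exact ⟨c, recurrencePts_subset h0 0 hc, hq⟩
  refine ⟨not_potClosed_ASet hS, ?_⟩
  rintro X Y tX tY hX hY A - hA ⟨u, v, hu, hv, rfl⟩
  have hZc : IsClosed {p : X × Y | u p.1 = v p.2} :=
    isClosed_eq (hu.comp continuous_fst) (hv.comp continuous_snd)
  have hZP : PolishSpace {p : X × Y | u p.1 = v p.2} := hZc.polishSpace
  let := TopologicalSpace.upgradeIsCompletelyMetrizable {p : X × Y | u p.1 = v p.2}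
  let π : {p : X × Y | u p.1 = v p.2} → Cantor := fun z => u z.1.1
  have hπ : Continuous π := hu.comp (continuous_fst.comp continuous_subtype_val)
  have hns : ¬ FlipSmall S (range π) := fun h => hA <| potClosed_preimage_of_flipSmall hu hv <|
    h.mono <| by
      rintro _ ⟨⟨x, rfl⟩, ⟨y, hy⟩⟩
      exact ⟨⟨(x, y), hy.symm⟩, rfl⟩
  obtain ⟨w, hw, n, y, hn, hy, ha⟩ := exists_cube hM hπ hns
  refine ⟨fun x => (w x).1.1, fun x => (w x).1.2,
    continuous_fst.comp (continuous_subtype_val.comp hw),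
    continuous_snd.comp (continuous_subtype_val.comp hw), ?_⟩
  ext ⟨x, x'⟩
  have h2 : v (w x').1.2 = π (w x') := (w x').2.symm
  rw [mem_preimage, mem_preimage, h2]
  exact (mem_ASet_cube_iff (a := fun x => π (w x)) hn hy ha x x').symm

end PotentiallyClosed

theorem stmt12 (α : Cantor) :
    CondM (Sbeta (betaSeq α)) ∧
    MinNonPotClosed inferInstance inferInstance (ASet (Sbeta (betaSeq α))) :=
  ⟨condM_Sbeta_betaSeq α, minNonPotClosed_ASet (zero_mem_Sbeta _) (condM_Sbeta_betaSeq α)⟩
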